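/- Let Ω ⊂ ℝ² be a bounded open set enclosed by a simple closed curve Γ = ∂Ω. If Ω is not convex, then there exists a homeomorphism γ : ∂𝔹 → ∂Ω of the unit circle onto Γ such that the harmonic extension φ of γ (the solution of Δφ = 0 in 𝔹 with φ = γ on ∂𝔹) is not a homeomorphism of cl(𝔹) onto cl(Ω); in particular, φ does not map 𝔹 into the interior of Ω. -/

import Mathlib

noncomputable section

open Set Metric Filter

/-- Euclidean dot product of two complex numbers viewed as vectors in ℝ². -/
def dotC (u v : ℂ) : ℝ := u.re * v.re + u.im * v.im

/-- Clockwise rotation by π/2 of a planar vector (identified with ℂ):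
`(x, y)^⊥ = (y, -x)`. -/
def perpC (z : ℂ) : ℂ := -Complex.I * z

/-- Cross product (2×2 determinant) of two planar vectors. -/
def crossC (u v : ℂ) : ℝ := u.re * v.im - u.im * v.re

/-- The Laplacian of a function `f : ℂ → ℝ` (ℂ is identified with ℝ²),
as the sum of the second derivatives in the two coordinate directions. -/
def lap2 (f : ℂ → ℝ) (z : ℂ) : ℝ :=
  fderiv ℝ (fun w => fderiv ℝ f w 1) z 1 +
  fderiv ℝ (fun w => fderiv ℝ f w Complex.I) z Complex.I

/-- `φ : ℂ → ℂ` is harmonic (componentwise, Δφ = 0) on the set `s`. -/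
def HarmonicOn2 (φ : ℂ → ℂ) (s : Set ℂ) : Prop :=
  ∀ z ∈ s, lap2 (fun w => (φ w).re) z = 0 ∧ lap2 (fun w => (φ w).im) z = 0

/-- The point `e^{iθ}` of the unit circle ∂𝔹. -/
def cpt (θ : ℝ) : ℂ := Complex.exp (θ * Complex.I)

open scoped Topology Laplacian
open InnerProductSpace

theorem lap2_eq_laplacian {f : ℂ → ℝ} {z : ℂ} (hf : ContDiffAt ℝ 2 f z) : lap2 f z = Δ f z := by
  have hd : DifferentiableAt ℝ (fderiv ℝ f) z :=
    (hf.fderiv_right (m := 1) le_rfl).differentiableAt one_ne_zero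
  have key (v : ℂ) : fderiv ℝ (fun w => fderiv ℝ f w v) z v = fderiv ℝ (fderiv ℝ f) z v v := by
    rw [fderiv_clm_apply hd (differentiableAt_const v)]
    simp
  simp [lap2, key, laplacian_eq_iteratedFDeriv_complexPlane, iteratedFDeriv_two_apply]

theorem HarmonicOn2.harmonicOnNhd {φ : ℂ → ℂ} {s : Set ℂ} (hs : IsOpen s)
    (hφ : ContDiffOn ℝ 2 φ s) (h : HarmonicOn2 φ s) : HarmonicOnNhd φ s := by
  intro z hz
  refine ⟨hφ.contDiffAt (hs.mem_nhds hz), ?_⟩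
  filter_upwards [hs.mem_nhds hz] with w hw
  have hc : ContDiffAt ℝ 2 φ w := hφ.contDiffAt (hs.mem_nhds hw)
  have hre := hc.laplacian_CLM_comp_left (l := Complex.reCLM)
  have him := hc.laplacian_CLM_comp_left (l := Complex.imCLM)
  rw [← lap2_eq_laplacian (Complex.reCLM.contDiff.contDiffAt.comp w hc)] at hre
  rw [← lap2_eq_laplacian (Complex.imCLM.contDiff.contDiffAt.comp w hc)] at him
  exact Complex.ext (hre.symm.trans (h w hw).1) (him.symm.trans (h w hw).2)

theorem HarmonicOn2.apply_zero_eq_integral {φ : ℂ → ℂ}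
    (hc : ContinuousOn φ (closedBall 0 1)) (hφ : ContDiffOn ℝ 2 φ (ball 0 1))
    (h : HarmonicOn2 φ (ball 0 1)) :
    φ 0 = (2 * Real.pi)⁻¹ • ∫ θ in (0 : ℝ)..2 * Real.pi, φ (cpt θ) := by
  have hh : HarmonicContOnCl φ (ball 0 |1|) := by
    simpa using HarmonicContOnCl.mk_ball (h.harmonicOnNhd isOpen_ball hφ) hc
  rw [← hh.circleAverage_eq, Real.circleAverage]
  simp [circleMap, cpt]

theorem cpt_mem_sphere (θ : ℝ) : cpt θ ∈ sphere (0 : ℂ) 1 := by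
  simp [cpt, Complex.norm_exp_ofReal_mul_I]

theorem cpt_add_pi (θ : ℝ) : cpt (θ + Real.pi) = -cpt θ := by
  simp [cpt, add_mul, Complex.exp_add, Complex.exp_pi_mul_I]

theorem continuous_cpt : Continuous cpt := by
  unfold cpt; fun_prop

theorem not_injective_of_continuous_sphere {f : sphere (0 : ℂ) 1 → ℝ} (hf : Continuous f) :
    ¬ Function.Injective f := by
  intro hinj
  let p : ℝ → sphere (0 : ℂ) 1 := fun θ => ⟨cpt θ, cpt_mem_sphere θ⟩
  have hp : Continuous p := continuous_cpt.subtype_mk _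
  let g : ℝ → ℝ := fun θ => f (p (θ + Real.pi)) - f (p θ)
  have hg : Continuous g := by fun_prop
  have hpp : p (0 + Real.pi + Real.pi) = p 0 := by
    apply Subtype.ext
    simp only [p, cpt_add_pi, neg_neg]
  have hg0 : g (0 + Real.pi) = -g 0 := by simp only [g, hpp]; ring
  have h0 : (0 : ℝ) ∈ range g := by
    rcases le_total (g 0) 0 with h | h
    · exact mem_range_of_exists_le_of_exists_ge hg ⟨_, h⟩ ⟨0 + Real.pi, by linarith⟩
    · exact mem_range_of_exists_le_of_exists_ge hg ⟨0 + Real.pi, by linarith⟩ ⟨_, h⟩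
  obtain ⟨θ, hθ⟩ := h0
  have h1 : cpt (θ + Real.pi) = cpt θ := congrArg Subtype.val (hinj (sub_eq_zero.mp hθ))
  rw [cpt_add_pi, neg_eq_self] at h1
  have := cpt_mem_sphere θ
  simp [h1] at this

theorem exists_int_of_apply_eq {E : Type*} {η : ℝ → E} {T : ℝ} (hT : 0 < T)
    (hper : Function.Periodic η T) (hinj : InjOn η (Ico 0 T)) {s t : ℝ} (h : η s = η t) :
    ∃ k : ℤ, s = t + k * T := by
  have hm (x : ℝ) : η (toIcoMod hT 0 x) = η x := hper.sub_zsmul_eq _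
  have hmem (x : ℝ) : toIcoMod hT 0 x ∈ Ico 0 T := by
    simpa using toIcoMod_mem_Ico hT 0 x
  have heq := hinj (hmem s) (hmem t) (by rw [hm, hm, h])
  refine ⟨toIcoDiv hT 0 s - toIcoDiv hT 0 t, ?_⟩
  have hs := toIcoMod_add_toIcoDiv_zsmul hT 0 s
  have ht := toIcoMod_add_toIcoDiv_zsmul hT 0 t
  rw [zsmul_eq_mul] at hs ht
  push_cast
  linarith

theorem injOn_Ico_of_periodic {E : Type*} {η : ℝ → E} {T : ℝ} (hT : 0 < T)
    (hper : Function.Periodic η T) (hinj : InjOn η (Ico 0 T)) (a : ℝ) :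
    InjOn η (Ico a (a + T)) := by
  intro s hs t ht h
  obtain ⟨k, hk⟩ := exists_int_of_apply_eq hT hper hinj h
  have h1 : (k : ℝ) < 1 := by
    by_contra! hc
    nlinarith [hs.2, ht.1]
  have h2 : (-1 : ℝ) < k := by
    by_contra! hc
    nlinarith [hs.1, ht.2]
  have : k = 0 := by
    have h1' : k < 1 := by exact_mod_cast h1
    have h2' : -1 < k := by exact_mod_cast h2
    omega
  simpa [this] using hk

theorem range_subset_frontier_of_convex {η : ℝ → ℂ} {T : ℝ} (hT : 0 < T)
    (hηc : Continuous η) (hper : Function.Periodic η T) (hinj : InjOn η (Ico 0 T))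
    {K : Set ℂ} (hK : Convex ℝ K) (hKi : (interior K).Nonempty) (hKb : Bornology.IsBounded K)
    (hsub : frontier K ⊆ range η) : range η ⊆ frontier K := by
  rintro _ ⟨a, rfl⟩
  by_contra ha
  let S : Set ℝ := Icc a (a + T) ∩ η ⁻¹' frontier K
  have hS : IsCompact S := isCompact_Icc.inter_right (isClosed_frontier.preimage hηc)
  have hSI : S ⊆ Ico a (a + T) := by
    rintro t ⟨ht, htK⟩
    refine ⟨ht.1, ht.2.lt_of_ne ?_⟩
    rintro rfl
    exact ha (by simpa [hper a] using htK)
  have hbij : BijOn η S (frontier K) := by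
    refine ⟨fun t ht => ht.2, (injOn_Ico_of_periodic hT hper hinj a).mono hSI, ?_⟩
    intro z hz
    obtain ⟨t, rfl⟩ := hsub hz
    obtain ⟨s, hs, hst⟩ := hper.exists_mem_Ico hT t a
    exact ⟨s, ⟨Ico_subset_Icc_self hs, by rwa [mem_preimage, ← hst]⟩, hst.symm⟩
  have : CompactSpace S := isCompact_iff_compactSpace.mp hS
  let e : S ≃ frontier K := hbij.equiv η
  have he : Continuous e := (hηc.comp continuous_subtype_val).subtype_mk _
  let e' : S ≃ₜ frontier K := he.homeoOfEquivCompactToT2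
  obtain ⟨h, -, -, hh⟩ := exists_homeomorph_image_interior_closure_frontier_eq_unitBall hK hKi hKb
  have hmem (w : sphere (0 : ℂ) 1) : h.symm w ∈ frontier K := by
    obtain ⟨v, hv, hvw⟩ := hh.symm.subset w.2
    simpa [← hvw] using hv
  let q : sphere (0 : ℂ) 1 → frontier K := fun w => ⟨h.symm w, hmem w⟩
  have hq : Continuous q := (h.symm.continuous.comp continuous_subtype_val).subtype_mk _
  refine not_injective_of_continuous_sphere (f := fun w => (e'.symm (q w) : ℝ))
    (continuous_subtype_val.comp (e'.symm.continuous.comp hq)) ?_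
  intro w v hwv
  have := congrArg Subtype.val (e'.symm.injective (Subtype.ext hwv))
  exact Subtype.ext (h.symm.injective this)

theorem exists_mem_frontier_segment {E : Type*} [NormedAddCommGroup E] [NormedSpace ℝ E]
    {K : Set E} {x z : E} (hx : x ∈ K) (hz : z ∉ K) : ∃ a ∈ frontier K, Wbtw ℝ x a z := by
  by_contra! hcon
  have hfr : ∀ w ∈ segment ℝ x z, w ∉ frontier K := fun w hw hwK =>
    hcon w hwK (mem_segment_iff_wbtw.mp hw)
  have hint : ∀ w ∈ segment ℝ x z, w ∈ closure K → w ∈ interior K := fun w hw hwK => by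
    by_contra h
    exact hfr w hw ⟨hwK, h⟩
  obtain ⟨w, -, hwi, hwc⟩ := (convex_segment (𝕜 := ℝ) x z).isPreconnected
    (interior K) (closure K)ᶜ isOpen_interior isClosed_closure.isOpen_compl
    (fun w hw => or_iff_not_imp_right.mpr fun h => hint w hw (not_not.mp h))
    ⟨x, left_mem_segment ℝ x z, hint x (left_mem_segment ℝ x z) (subset_closure hx)⟩
    ⟨z, right_mem_segment ℝ x z, fun h =>
      hz (interior_subset (hint z (right_mem_segment ℝ x z) h))⟩
  exact hwc (interior_subset_closure hwi)

theorem exists_frontier_wbtw_notMem_of_not_convex {E : Type*} [NormedAddCommGroup E]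
    [NormedSpace ℝ E] {K : Set E} (hK : ¬ Convex ℝ K) :
    ∃ a ∈ frontier K, ∃ b ∈ frontier K, ∃ z ∉ K, Wbtw ℝ a z b := by
  rw [convex_iff_segment_subset] at hK
  push Not at hK
  obtain ⟨x, hx, y, hy, hxy⟩ := hK
  obtain ⟨z, hz, hzK⟩ := not_subset.mp hxy
  rw [mem_segment_iff_wbtw] at hz
  obtain ⟨a, ha, hxaz⟩ := exists_mem_frontier_segment hx hzK
  obtain ⟨b, hb, hybz⟩ := exists_mem_frontier_segment hy hzK
  exact ⟨a, ha, b, hb, z, hzK, ((hz.trans_left_right hxaz).symm.trans_left_right hybz).symm⟩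

theorem exists_chord_notMem_closure {Ω : Set ℂ} {η : ℝ → ℂ} {T : ℝ} (hT : 0 < T)
    (hΩo : IsOpen Ω) (hΩb : Bornology.IsBounded Ω)
    (hηc : Continuous η) (hper : Function.Periodic η T) (hinj : InjOn η (Ico 0 T))
    (hrange : range η = frontier Ω) (hΩ : ¬ Convex ℝ Ω) :
    ∃ a ∈ frontier Ω, ∃ b ∈ frontier Ω, ∃ z ∉ closure Ω, Wbtw ℝ a z b := by
  have hfr : frontier (closure Ω) ⊆ frontier Ω := frontier_closure_subset
  have hcl : ¬ Convex ℝ (closure Ω) := by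
    intro hK
    have hne : Ω.Nonempty := by
      rw [nonempty_iff_ne_empty]
      rintro rfl
      exact hΩ convex_empty
    have hsub : Ω ⊆ interior (closure Ω) := hΩo.subset_interior_closure
    have h := range_subset_frontier_of_convex hT hηc hper hinj hK (hne.mono hsub) hΩb.closure
      (hrange ▸ hfr)
    have hint : interior (closure Ω) = Ω := by
      refine Subset.antisymm (fun x hx => ?_) hsub
      by_contra hxΩ
      have hxf : x ∈ frontier Ω := by
        rw [hΩo.frontier_eq]
        exact ⟨interior_subset hx, hxΩ⟩
      exact (h (hrange ▸ hxf)).2 hx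
    exact hΩ (hint ▸ hK.interior)
  obtain ⟨a, ha, b, hb, z, hz, h⟩ := exists_frontier_wbtw_notMem_of_not_convex hcl
  exact ⟨a, hfr ha, b, hfr hb, z, hz, h⟩

/-- A reparametrization of `[0, T]` that, for large `n`, stays close to `0` on most of `[0, c]`
and close to `β` on most of `[c, T]`. -/
def stepReparam (T c β : ℝ) (n : ℕ) (θ : ℝ) : ℝ :=
  β * (min θ c / c) ^ n + (T - β) * ((max θ c - c) / (T - c)) ^ n

section stepReparam

variable {T c β : ℝ} {n : ℕ} {θ : ℝ}

theorem continuous_stepReparam : Continuous (stepReparam T c β n) := by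
  unfold stepReparam; fun_prop

theorem stepReparam_of_le (hn : n ≠ 0) (hθ : θ ≤ c) :
    stepReparam T c β n θ = β * (θ / c) ^ n := by
  simp [stepReparam, hθ, hn]

theorem stepReparam_of_ge (hc : 0 < c) (hθ : c ≤ θ) :
    stepReparam T c β n θ = β + (T - β) * ((θ - c) / (T - c)) ^ n := by
  simp [stepReparam, hθ, hc.ne']

theorem stepReparam_zero (hc : 0 < c) (hn : n ≠ 0) : stepReparam T c β n 0 = 0 := by
  simp [stepReparam_of_le hn hc.le, hn]

theorem stepReparam_period (hc : 0 < c) (hcT : c < T) : stepReparam T c β n T = T := by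
  simp [stepReparam_of_ge hc hcT.le, (sub_pos.mpr hcT).ne']

theorem strictMonoOn_stepReparam (hc : 0 < c) (hcT : c < T) (hβ : 0 < β) (hβT : β < T)
    (hn : n ≠ 0) : StrictMonoOn (stepReparam T c β n) (Icc 0 T) := by
  have h1 : StrictMonoOn (stepReparam T c β n) (Icc 0 c) := by
    intro x hx y hy hxy
    rw [stepReparam_of_le hn hx.2, stepReparam_of_le hn hy.2]
    have := hx.1
    gcongr
  have h2 : StrictMonoOn (stepReparam T c β n) (Icc c T) := by
    intro x hx y hy hxy
    rw [stepReparam_of_ge hc hx.1, stepReparam_of_ge hc hy.1]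
    have := sub_nonneg.mpr hx.1
    have := sub_pos.mpr hcT
    have := sub_pos.mpr hβT
    gcongr
  rw [← Icc_union_Icc_eq_Icc hc.le hcT.le]
  exact h1.union h2 (isGreatest_Icc hc.le) (isLeast_Icc hcT.le)

theorem image_stepReparam (hc : 0 < c) (hcT : c < T) (hβ : 0 < β) (hβT : β < T)
    (hn : n ≠ 0) : stepReparam T c β n '' Icc 0 T = Icc 0 T := by
  have hT : 0 ≤ T := (hc.trans hcT).le
  have hmono := (strictMonoOn_stepReparam hc hcT hβ hβT hn).monotoneOn
  refine Subset.antisymm ?_ ?_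
  · rintro _ ⟨θ, hθ, rfl⟩
    constructor
    · simpa [stepReparam_zero hc hn] using hmono (left_mem_Icc.mpr hT) hθ hθ.1
    · simpa [stepReparam_period hc hcT] using hmono hθ (right_mem_Icc.mpr hT) hθ.2
  · simpa [stepReparam_zero hc hn, stepReparam_period hc hcT] using
      intermediate_value_Icc hT (continuous_stepReparam (T := T) (c := c) (β := β)
        (n := n)).continuousOn

theorem tendsto_stepReparam_of_lt (hc : 0 < c) (hθ : 0 ≤ θ) (hθc : θ < c) :
    Tendsto (fun n => stepReparam T c β n θ) atTop (𝓝 0) := by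
  have h : Tendsto (fun n : ℕ => β * (θ / c) ^ n) atTop (𝓝 (β * 0)) :=
    (tendsto_pow_atTop_nhds_zero_of_lt_one (by positivity) ((div_lt_one hc).mpr hθc)).const_mul β
  rw [mul_zero] at h
  refine h.congr' ?_
  filter_upwards [eventually_ne_atTop 0] with n hn
  exact (stepReparam_of_le hn hθc.le).symm

theorem tendsto_stepReparam_of_ge (hc : 0 < c) (hθc : c ≤ θ) (hθT : θ < T) :
    Tendsto (fun n => stepReparam T c β n θ) atTop (𝓝 β) := by
  have hcT : 0 < T - c := by linarith
  have h : Tendsto (fun n : ℕ => β + (T - β) * ((θ - c) / (T - c)) ^ n) atTop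
      (𝓝 (β + (T - β) * 0)) :=
    ((tendsto_pow_atTop_nhds_zero_of_lt_one (div_nonneg (by linarith) hcT.le)
      ((div_lt_one hcT).mpr (by linarith))).const_mul (T - β)).const_add β
  rw [mul_zero, add_zero] at h
  exact h.congr fun n => (stepReparam_of_ge hc hθc).symm

theorem tendsto_integral_stepReparam {η : ℝ → ℂ} (hη : Continuous η) (hc : 0 < c) (hcT : c < T)
    (hβ : 0 < β) (hβT : β < T) :
    Tendsto (fun n => ∫ θ in 0..T, η (stepReparam T c β n θ)) atTop
      (𝓝 (c • η 0 + (T - c) • η β)) := by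
  have hT : 0 < T := hc.trans hcT
  obtain ⟨C, hC⟩ := isCompact_Icc (a := (0 : ℝ)) (b := T) |>.exists_bound_of_continuousOn
    hη.continuousOn
  have hbound {a b : ℝ} (ha : 0 ≤ a) (hab : a ≤ b) (hb : b ≤ T) (n : ℕ) (hn : n ≠ 0) (θ : ℝ)
      (hθ : θ ∈ Set.uIoc a b) : ‖η (stepReparam T c β n θ)‖ ≤ C := by
    rw [uIoc_of_le hab] at hθ
    exact hC _ ((image_stepReparam hc hcT hβ hβT hn).subset
      ⟨θ, ⟨ha.trans hθ.1.le, hθ.2.trans hb⟩, rfl⟩)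
  have hcont (n : ℕ) : Continuous fun θ => η (stepReparam T c β n θ) :=
    hη.comp continuous_stepReparam
  have hlim {a b : ℝ} {w : ℂ} (ha : 0 ≤ a) (hab : a ≤ b) (hb : b ≤ T)
      (h : ∀ θ, a < θ → θ < b → Tendsto (fun n => η (stepReparam T c β n θ)) atTop (𝓝 w)) :
      Tendsto (fun n => ∫ θ in a..b, η (stepReparam T c β n θ)) atTop (𝓝 ((b - a) • w)) := by
    rw [← intervalIntegral.integral_const]
    refine intervalIntegral.tendsto_integral_filter_of_dominated_convergence (fun _ => C)
      (.of_forall fun n => (hcont n).aestronglyMeasurable) ?_ intervalIntegrable_const ?_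
    · filter_upwards [eventually_ne_atTop 0] with n hn
      exact .of_forall fun θ hθ => hbound ha hab hb n hn θ hθ
    · filter_upwards [MeasureTheory.Measure.ae_ne MeasureTheory.volume b] with θ hne hθ
      rw [uIoc_of_le hab] at hθ
      exact h θ hθ.1 (hθ.2.lt_of_ne hne)
  have h1 := hlim le_rfl hc.le hcT.le fun θ h0 h1 =>
    (hη.tendsto 0).comp (tendsto_stepReparam_of_lt (T := T) (β := β) hc h0.le h1)
  have h2 := hlim hc.le hcT.le le_rfl fun θ h0 h1 =>
    (hη.tendsto β).comp (tendsto_stepReparam_of_ge hc h0.le h1)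
  rw [sub_zero] at h1
  refine (h1.add h2).congr fun n => ?_
  exact intervalIntegral.integral_add_adjacent_intervals ((hcont n).intervalIntegrable _ _)
    ((hcont n).intervalIntegrable _ _)

end stepReparam

theorem exists_periodic_of_monotone_reparam {η : ℝ → ℂ} {T : ℝ} (hT : 0 < T) {h : ℝ → ℝ}
    (hηc : Continuous η) (hper : Function.Periodic η T) (hinj : InjOn η (Ico 0 T))
    (hc : Continuous h) (hmono : StrictMonoOn h (Icc 0 T)) (himg : h '' Icc 0 T = Icc 0 T)
    (h0 : h 0 = 0) (h1 : h T = T) :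
    ∃ γ : ℝ → ℂ, Continuous γ ∧ Function.Periodic γ T ∧ InjOn γ (Ico 0 T) ∧
      range γ = range η ∧ EqOn γ (η ∘ h) (Icc 0 T) := by
  have : Fact (0 < T) := ⟨hT⟩
  have hend : (η ∘ h) 0 = (η ∘ h) T := by simpa [h0, h1] using (hper 0).symm
  let γ : ℝ → ℂ := fun θ => AddCircle.liftIco T 0 (η ∘ h) (θ : AddCircle T)
  have hγper : Function.Periodic γ T := fun θ => by simp [γ]
  have hγIco : EqOn γ (η ∘ h) (Ico 0 T) := fun θ hθ => AddCircle.liftIco_zero_coe_apply hθ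
  have hγ : EqOn γ (η ∘ h) (Icc 0 T) := by
    intro θ hθ
    rcases hθ.2.eq_or_lt with rfl | hlt
    · rw [← hend, ← hγIco (left_mem_Ico.mpr hT), ← hγper 0, zero_add]
    · exact hγIco ⟨hθ.1, hlt⟩
  refine ⟨γ, (AddCircle.liftIco_zero_continuous hend (hηc.comp hc).continuousOn).comp
    (AddCircle.continuous_mk' T), hγper, ?_, ?_, hγ⟩
  · have hmaps : MapsTo h (Ico 0 T) (Ico 0 T) := by
      intro θ hθ
      have hθ' := Ico_subset_Icc_self hθ
      refine ⟨(himg.subset ⟨θ, hθ', rfl⟩).1, ?_⟩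
      simpa [h1] using hmono hθ' (right_mem_Icc.mpr hT.le) hθ.2
    exact (hinj.comp (hmono.injOn.mono Ico_subset_Icc_self) hmaps).congr hγIco.symm
  · have hγr : range γ = γ '' Icc 0 T := by
      simpa using (hγper.image_Icc hT 0).symm
    have hηr : range η = η '' Icc 0 T := by
      simpa using (hper.image_Icc hT 0).symm
    rw [hγr, hηr, hγ.image_eq, image_comp, himg]

theorem exists_parametrization_mean_near {η : ℝ → ℂ} {T : ℝ} (hT : 0 < T)
    (hηc : Continuous η) (hper : Function.Periodic η T) (hinj : InjOn η (Ico 0 T))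
    {a b z : ℂ} (ha : a ∈ range η) (hb : b ∈ range η) (hz : Sbtw ℝ a z b)
    {U : Set ℂ} (hU : U ∈ 𝓝 z) :
    ∃ γ : ℝ → ℂ, Continuous γ ∧ Function.Periodic γ T ∧ InjOn γ (Ico 0 T) ∧
      range γ = range η ∧ T⁻¹ • ∫ θ in 0..T, γ θ ∈ U := by
  obtain ⟨α, rfl⟩ := ha
  let ζ : ℝ → ℂ := fun t => η (α + t)
  have hζc : Continuous ζ := hηc.comp (continuous_const_add α)
  have hζper : Function.Periodic ζ T := fun t => by simp only [ζ, ← add_assoc, hper _]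
  have hζinj : InjOn ζ (Ico 0 T) := by
    intro s hs t ht hst
    exact add_left_cancel (injOn_Ico_of_periodic hT hper hinj α
      ⟨by linarith [hs.1], by linarith [hs.2]⟩ ⟨by linarith [ht.1], by linarith [ht.2]⟩ hst)
  have hζr : range ζ = range η := (Equiv.addLeft α).surjective.range_comp η
  rw [← hζr] at hb ⊢
  obtain ⟨β', rfl⟩ := hb
  obtain ⟨β, hβ, hββ⟩ := hζper.exists_mem_Ico₀ hT β'
  rw [hββ] at hz
  have hζ0 : ζ 0 = η α := by simp [ζ]
  rw [← hζ0] at hz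
  have hβ0 : 0 < β := hβ.1.lt_of_ne fun h => hz.left_ne_right (by rw [h])
  obtain ⟨s, ⟨hs0, hs1⟩, rfl⟩ := (sbtw_iff_mem_image_Ioo_and_ne.mp hz).1
  have hc : 0 < T * (1 - s) := mul_pos hT (by linarith)
  have hcT : T * (1 - s) < T := by nlinarith
  have hlim := (tendsto_integral_stepReparam hζc hc hcT hβ0 hβ.2).const_smul T⁻¹
  have heq : T⁻¹ • ((T * (1 - s)) • ζ 0 + (T - T * (1 - s)) • ζ β)
      = AffineMap.lineMap (ζ 0) (ζ β) s := by
    rw [AffineMap.lineMap_apply_module, smul_add, smul_smul, smul_smul]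
    congr 2 <;> field_simp
    ring
  rw [heq] at hlim
  obtain ⟨n, hnU, hn⟩ := ((hlim.eventually_mem hU).and (eventually_ne_atTop 0)).exists
  obtain ⟨γ, hγc, hγp, hγi, hγr, hγ⟩ := exists_periodic_of_monotone_reparam hT hζc hζper hζinj
    continuous_stepReparam (strictMonoOn_stepReparam hc hcT hβ0 hβ.2 hn)
    (image_stepReparam hc hcT hβ0 hβ.2 hn) (stepReparam_zero hc hn) (stepReparam_period hc hcT)
  refine ⟨γ, hγc, hγp, hγi, hγr, ?_⟩
  rw [intervalIntegral.integral_congr (g := ζ ∘ stepReparam T (T * (1 - s)) β n)]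
  · exact hnU
  · rwa [uIcc_of_le hT.le]

/-- Choquet, Theorem 2 of the paper. Let `Ω` be a bounded open set whose
frontier `Γ = ∂Ω` is a simple closed curve (i.e. it admits a continuous `2π`-periodic
parametrization `η`, injective on a period, with range `frontier Ω`). If `Ω` is not convex,
then there exists a homeomorphism `γ` of the unit circle onto `Γ` such that any harmonic
extension `φ` of `γ` (continuous on `cl 𝔹`, `C²` and componentwise harmonic in `𝔹`, equal
to `γ` on `∂𝔹`) is not a homeomorphism of `cl 𝔹` onto `cl Ω`; in particular, `φ` does not
map `𝔹` into the interior `Ω`. -/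
theorem choquet_nonconvex_counterexample
    (Ω : Set ℂ) (η : ℝ → ℂ)
    (hΩo : IsOpen Ω) (hΩb : Bornology.IsBounded Ω)
    (hηc : Continuous η) (hηper : ∀ θ, η (θ + 2 * Real.pi) = η θ)
    (hηinj : Set.InjOn η (Set.Ico 0 (2 * Real.pi)))
    (hηrange : Set.range η = frontier Ω)
    (hnconv : ¬ Convex ℝ Ω) :
    ∃ γ : ℝ → ℂ, Continuous γ ∧ (∀ θ, γ (θ + 2 * Real.pi) = γ θ) ∧
      Set.InjOn γ (Set.Ico 0 (2 * Real.pi)) ∧ Set.range γ = frontier Ω ∧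
      ∀ φ : ℂ → ℂ, ContinuousOn φ (closedBall (0 : ℂ) 1) →
        ContDiffOn ℝ 2 φ (ball (0 : ℂ) 1) → HarmonicOn2 φ (ball (0 : ℂ) 1) →
        (∀ θ : ℝ, φ (cpt θ) = γ θ) →
        ¬ Set.BijOn φ (closedBall (0 : ℂ) 1) (closure Ω) ∧
        ¬ Set.MapsTo φ (ball (0 : ℂ) 1) Ω := by
  have hT : 0 < 2 * Real.pi := Real.two_pi_pos
  obtain ⟨a, ha, b, hb, z, hz, hab⟩ :=
    exists_chord_notMem_closure hT hΩo hΩb hηc hηper hηinj hηrange hnconv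
  have hsb : Sbtw ℝ a z b := by
    refine ⟨hab, ?_, ?_⟩
    · rintro rfl
      exact hz ha.1
    · rintro rfl
      exact hz hb.1
  obtain ⟨γ, hγc, hγp, hγi, hγr, hγ⟩ := exists_parametrization_mean_near hT hηc hηper hηinj
    (hηrange ▸ ha) (hηrange ▸ hb) hsb (isClosed_closure.isOpen_compl.mem_nhds hz)
  refine ⟨γ, hγc, hγp, hγi, hγr.trans hηrange, fun φ hφc hφd hφh hφγ => ?_⟩
  have h0 : φ 0 ∉ closure Ω := by
    rw [hφh.apply_zero_eq_integral hφc hφd]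
    simpa only [hφγ, mem_compl_iff] using hγ
  exact ⟨fun h => h0 (h.mapsTo (mem_closedBall_self zero_le_one)),
    fun h => h0 (subset_closure (h (mem_ball_self one_pos)))⟩
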